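/- Let g be a Lie algebra over a field k of characteristic zero, written as a direct sum of vector subspaces g = g_- ⊕ h where h is a Lie subalgebra. Then the multiplication map U(g_-, g) ⊗ U(h) → U(g), Σ g_i ⊗ h_i ↦ Σ g_i h_i, is a linear isomorphism, where U(g_-, g) denotes the linear span in U(g) of 1 and of all symmetrized products (1/n!) Σ_{σ ∈ S_n} x_{σ(1)} ⋯ x_{σ(n)} with x_1, …, x_n ∈ g_-. -/

import Mathlib

/-! Statement 4: if `g = g₋ ⊕ h` as vector spaces (with `h` a Lie subalgebra and
`g₋` merely a linear complement), then multiplication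
`U(g₋, g) ⊗ U(h) → U(g)` is a linear isomorphism, where `U(g₋, g)` is the span
of `1` and of all symmetrized products `(1/n!) Σ_σ x_{σ(1)} ⋯ x_{σ(n)}` of
elements of `g₋`. -/

open TensorProduct

noncomputable section

variable (k : Type*) [Field k] [CharZero k]
variable (g : Type*) [LieRing g] [LieAlgebra k g]

/-- The span `U(g₋, g)` in `U(g)` of `1` and all symmetrized products of
elements of a subspace `g₋ ⊆ g`. -/
def symmPart (gneg : Submodule k g) : Submodule k (UniversalEnvelopingAlgebra k g) :=
  Submodule.span k
    ({1} ∪ { x | ∃ n : ℕ, 0 < n ∧ ∃ f : Fin n → gneg,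
        x = (n.factorial : k)⁻¹ •
          ∑ σ : Equiv.Perm (Fin n),
            (List.ofFn fun i => UniversalEnvelopingAlgebra.ι k ((f (σ i)) : g)).prod })

/-- The image `U(h)` of the enveloping algebra of the subalgebra `h` in `U(g)`,
i.e. the subalgebra generated by `ι(h)`. -/
def envOfSub (h : LieSubalgebra k g) : Subalgebra k (UniversalEnvelopingAlgebra k g) :=
  Algebra.adjoin k (UniversalEnvelopingAlgebra.ι k '' (h : Set g))

/-- The multiplication map `U(g₋, g) ⊗ U(h) → U(g)`, `Σ gᵢ ⊗ hᵢ ↦ Σ gᵢ hᵢ`. -/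
def pbwMul (gneg : Submodule k g) (h : LieSubalgebra k g) :
    (symmPart k g gneg ⊗[k] Subalgebra.toSubmodule (envOfSub k g h)) →ₗ[k]
      UniversalEnvelopingAlgebra k g :=
  TensorProduct.lift
    (((LinearMap.mul k (UniversalEnvelopingAlgebra k g)).comp
        (symmPart k g gneg).subtype).compl₂
      (Subalgebra.toSubmodule (envOfSub k g h)).subtype)

section PBWRep
variable {F : Type*} [Field F] {L : Type*} [LieRing L] [LieAlgebra F L] {ι : Type*}

/-- Elements of degree `< n`. -/
def degLT (F : Type*) [Field F] (ι : Type*) (n : ℕ) : Submodule F (Multiset ι →₀ F) :=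
  Finsupp.supported F F {M | M.card < n}

lemma degLT_mono {m n : ℕ} (h : m ≤ n) : degLT F ι m ≤ degLT F ι n :=
  Finsupp.supported_mono (fun _ hM => lt_of_lt_of_le hM h)

lemma single_mem_degLT {M : Multiset ι} {n : ℕ} (h : M.card < n) (c : F) :
    Finsupp.single M c ∈ degLT F ι n :=
  Finsupp.single_mem_supported F c h

lemma degLT_induction {n : ℕ} {P : Submodule F (Multiset ι →₀ F)}
    (h : ∀ M : Multiset ι, M.card < n → Finsupp.single M 1 ∈ P) : degLT F ι n ≤ P := by
  rw [degLT, Finsupp.supported_eq_span_single, Submodule.span_le]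
  rintro _ ⟨M, hM, rfl⟩
  exact h M hM

/-- Bilinear extension of an action on basis elements. -/
def extAct (b : Module.Basis ι F L) (a : ι → Multiset ι → (Multiset ι →₀ F)) :
    L →ₗ[F] (Multiset ι →₀ F) →ₗ[F] (Multiset ι →₀ F) :=
  b.constr F (fun i => Finsupp.linearCombination F (a i))

lemma extAct_basis (b : Module.Basis ι F L) (a : ι → Multiset ι → (Multiset ι →₀ F)) (i : ι)
    (v : Multiset ι →₀ F) : extAct b a (b i) v = Finsupp.linearCombination F (a i) v := by
  simp [extAct]

lemma extAct_single (b : Module.Basis ι F L) (a : ι → Multiset ι → (Multiset ι →₀ F)) (i : ι)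
    (M : Multiset ι) : extAct b a (b i) (Finsupp.single M 1) = a i M := by
  simp [extAct_basis]

lemma extAct_congr (b : Module.Basis ι F L) (a a' : ι → Multiset ι → (Multiset ι →₀ F)) (n : ℕ)
    (h : ∀ i M, M.card < n → a i M = a' i M) (x : L) (v : Multiset ι →₀ F)
    (hv : v ∈ degLT F ι n) : extAct b a x v = extAct b a' x v := by
  have : (extAct b a).flip v = (extAct b a').flip v := by
    refine b.ext fun i => ?_
    simp only [LinearMap.flip_apply, extAct_basis, Finsupp.linearCombination_apply]
    refine Finsupp.sum_congr fun M hM => ?_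
    rw [h i M (hv hM)]
  exact LinearMap.congr_fun this x

variable [LinearOrder ι] (b : Module.Basis ι F L)

open Classical in
/-- Stage `n` of the construction: correct up to degree `n`. -/
def stage : ℕ → ι → Multiset ι → (Multiset ι →₀ F)
  | 0, i, M => Finsupp.single (i ::ₘ M) 1
  | n + 1, i, M =>
    if M.card ≤ n then stage n i M
    else if h : ∃ p : ι × Multiset ι, M = p.1 ::ₘ p.2 ∧ (∀ a ∈ p.2, p.1 ≤ a) ∧ p.1 < i then
      Finsupp.single (i ::ₘ M) 1
        + extAct b (stage n) (b h.choose.1)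
          (stage n i h.choose.2 - Finsupp.single (i ::ₘ h.choose.2) 1)
        + extAct b (stage n) ⁅b i, b h.choose.1⁆ (Finsupp.single h.choose.2 1)
    else Finsupp.single (i ::ₘ M) 1

/-- The action of basis elements on monomials. -/
def act (i : ι) (M : Multiset ι) : Multiset ι →₀ F := stage b M.card i M

lemma stage_eq (n : ℕ) (i : ι) (M : Multiset ι) (h : M.card ≤ n) : stage b n i M = act b i M := by
  induction n with
  | zero => have : M.card = 0 := by omega
            rw [act, this]
  | succ n ih =>
    by_cases h' : M.card ≤ n
    · rw [← ih h', stage, if_pos h']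
    · have : M.card = n + 1 := by omega
      rw [act, this]

lemma extAct_stage (n : ℕ) (x : L) (v : Multiset ι →₀ F) (hv : v ∈ degLT F ι (n + 1)) :
    extAct b (stage b n) x v = extAct b (act b) x v :=
  extAct_congr b _ _ (n + 1) (fun i M h => stage_eq b n i M (by omega)) x v hv

lemma act_of_le (i : ι) (M : Multiset ι) (h : ∀ a ∈ M, i ≤ a) :
    act b i M = Finsupp.single (i ::ₘ M) 1 := by
  rcases hM : M.card with _ | n
  · rw [act, hM, stage]
  · rw [act, hM, stage, if_neg (by omega), dif_neg]
    rintro ⟨p, rfl, -, h3⟩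
    exact absurd (h p.1 (by simp)) (not_le.2 h3)

lemma act_of_lt' (i j : ι) (N : Multiset ι) (h : ∀ a ∈ N, j ≤ a) (hji : j < i)
    (hN : act b i N - Finsupp.single (i ::ₘ N) 1 ∈ degLT F ι (N.card + 1)) :
    act b i (j ::ₘ N) = Finsupp.single (i ::ₘ j ::ₘ N) 1
      + extAct b (act b) (b j) (act b i N - Finsupp.single (i ::ₘ N) 1)
      + extAct b (act b) ⁅b i, b j⁆ (Finsupp.single N 1) := by
  have hex : ∃ p : ι × Multiset ι, j ::ₘ N = p.1 ::ₘ p.2 ∧ (∀ a ∈ p.2, p.1 ≤ a) ∧ p.1 < i :=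
    ⟨(j, N), rfl, h, hji⟩
  have hch : hex.choose = (j, N) := by
    obtain ⟨h1, h2, h3⟩ := hex.choose_spec
    generalize hex.choose = p at h1 h2 h3
    obtain ⟨j', N'⟩ := p
    simp only at h1 h2 h3
    have hj : j' = j := by
      apply le_antisymm
      · have : j ∈ j' ::ₘ N' := h1 ▸ Multiset.mem_cons_self j N
        rcases Multiset.mem_cons.1 this with e | e
        · exact e.ge
        · exact h2 _ e
      · have : j' ∈ j ::ₘ N := h1 ▸ Multiset.mem_cons_self j' N'
        rcases Multiset.mem_cons.1 this with e | e
        · exact e.ge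
        · exact h _ e
    subst hj
    rw [(Multiset.cons_inj_right _).1 h1]
  have e : stage b N.card i N = act b i N := rfl
  rw [act, Multiset.card_cons, stage, if_neg (by simp), dif_pos hex, hch]
  simp only [e]
  rw [extAct_stage b _ _ _ hN, extAct_stage b _ _ _ (single_mem_degLT (by omega) _)]

lemma extAct_degLT (n : ℕ)
    (h : ∀ i M, M.card < n → act b i M - Finsupp.single (i ::ₘ M) 1 ∈ degLT F ι (M.card + 1))
    (x : L) (v : Multiset ι →₀ F) (hv : v ∈ degLT F ι n) :
    extAct b (act b) x v ∈ degLT F ι (n + 1) := by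
  have h1 : ∀ i : ι, degLT F ι n ≤ (degLT F ι (n + 1)).comap (extAct b (act b) (b i)) := by
    intro i
    refine degLT_induction fun M hM => ?_
    rw [Submodule.mem_comap, extAct_single]
    have := Submodule.add_mem _ (degLT_mono (by omega : M.card + 1 ≤ n + 1) (h i M hM))
      (single_mem_degLT (F := F) (M := i ::ₘ M) (n := n + 1) (by simpa using hM) 1)
    simpa using this
  have h2 : (⊤ : Submodule F L) ≤ (degLT F ι (n + 1)).comap ((extAct b (act b)).flip v) := by
    rw [← b.span_eq, Submodule.span_le]
    rintro _ ⟨i, rfl⟩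
    exact h1 i hv
  exact h2 (Submodule.mem_top : x ∈ ⊤)

lemma mset_min_cases (M : Multiset ι) (i : ι) : (∀ a ∈ M, i ≤ a) ∨
    ∃ j N, M = j ::ₘ N ∧ (∀ a ∈ N, j ≤ a) ∧ j < i := by
  by_cases h : ∀ a ∈ M, i ≤ a
  · exact Or.inl h
  · right
    push Not at h
    obtain ⟨c, hc, hci⟩ := h
    obtain ⟨j, hj, hmin⟩ := M.toFinset.exists_min_image id ⟨c, by simpa using hc⟩
    simp only [Multiset.mem_toFinset, id] at hj hmin
    obtain ⟨N, rfl⟩ := Multiset.exists_cons_of_mem hj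
    exact ⟨j, N, rfl, fun a ha => hmin a (by simp [ha]), lt_of_le_of_lt (hmin c hc) hci⟩

lemma act_lead (n : ℕ) : ∀ (i : ι) (M : Multiset ι), M.card < n →
    act b i M - Finsupp.single (i ::ₘ M) 1 ∈ degLT F ι (M.card + 1) := by
  induction n with
  | zero => intro i M h; omega
  | succ n ih =>
    intro i M hM
    rcases mset_min_cases M i with h | ⟨j, N, rfl, h, hji⟩
    · rw [act_of_le b i M h, sub_self]; exact zero_mem _
    · rw [Multiset.card_cons] at hM ⊢
      have hN := ih i N (by omega)
      rw [act_of_lt' b i j N h hji hN, add_assoc (Finsupp.single _ _), add_sub_cancel_left]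
      have ih' : ∀ i M, M.card < N.card + 1 →
        act b i M - Finsupp.single (i ::ₘ M) 1 ∈ degLT F ι (M.card + 1) :=
          fun i M h => ih i M (by omega)
      exact add_mem (extAct_degLT b _ ih' _ _ hN)
        (extAct_degLT b _ ih' _ _ (single_mem_degLT (by omega) _))

lemma act_of_lt (i j : ι) (N : Multiset ι) (h : ∀ a ∈ N, j ≤ a) (hji : j < i) :
    extAct b (act b) (b i) (extAct b (act b) (b j) (Finsupp.single N 1)) =
      extAct b (act b) (b j) (extAct b (act b) (b i) (Finsupp.single N 1))
      + extAct b (act b) ⁅b i, b j⁆ (Finsupp.single N 1) := by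
  rw [extAct_single, extAct_single, act_of_le b j N h, extAct_single,
    act_of_lt' b i j N h hji (act_lead b _ _ _ (Nat.lt_succ_self _)), map_sub, extAct_single,
    act_of_le b j (i ::ₘ N), Multiset.cons_swap]
  · abel
  · intro a ha
    rcases Multiset.mem_cons.1 ha with rfl | ha
    · exact hji.le
    · exact h a ha

lemma act_comm (n : ℕ) : ∀ (x y : L) (v : Multiset ι →₀ F), v ∈ degLT F ι n →
    extAct b (act b) x (extAct b (act b) y v) =
      extAct b (act b) y (extAct b (act b) x v) + extAct b (act b) ⁅x, y⁆ v := by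
  set A := extAct b (act b) with hA
  induction n with
  | zero =>
    intro x y v hv
    have : v = 0 := by
      have : degLT F ι 0 ≤ ⊥ := degLT_induction fun M hM => by omega
      simpa using this hv
    simp [this]
  | succ n ih =>
    -- ordered basis elements
    have key : ∀ (i j : ι) (M : Multiset ι), j < i → M.card < n + 1 →
        A (b i) (A (b j) (Finsupp.single M 1)) =
        A (b j) (A (b i) (Finsupp.single M 1)) + A ⁅b i, b j⁆ (Finsupp.single M 1) := by
      intro i j M hji hM
      rcases mset_min_cases M j with h | ⟨l, N, rfl, h, hlj⟩
      · exact act_of_lt b i j M h hji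
      · rw [Multiset.card_cons] at hM
        have hz : (Finsupp.single (l ::ₘ N) 1 : Multiset ι →₀ F) = A (b l) (Finsupp.single N 1) := by
          rw [hA, extAct_single, act_of_le b l N h]
        have hNmem : (Finsupp.single N 1 : Multiset ι →₀ F) ∈ degLT F ι n :=
          single_mem_degLT (by omega) _
        -- the relation for `l` and `p` applied to `A (b q) z_N`
        have aux : ∀ p q : ι, l < p → l < q →
            A (b p) (A (b l) (A (b q) (Finsupp.single N 1))) =
            A (b l) (A (b p) (A (b q) (Finsupp.single N 1)))
              + A ⁅b p, b l⁆ (A (b q) (Finsupp.single N 1)) := by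
          intro p q hp hq
          have e : A (b q) (Finsupp.single N 1) =
              Finsupp.single (q ::ₘ N) 1 + (act b q N - Finsupp.single (q ::ₘ N) 1) := by
            rw [hA, extAct_single]; abel
          have h1 := act_of_lt b p l (q ::ₘ N) (by
            intro a ha
            rcases Multiset.mem_cons.1 ha with rfl | ha
            · exact hq.le
            · exact h a ha) hp
          have h2 := ih (b p) (b l) (act b q N - Finsupp.single (q ::ₘ N) 1)
            (degLT_mono (by omega) (act_lead b _ q N (Nat.lt_succ_self _)))
          rw [e]
          simp only [map_add]
          rw [← hA] at h1
          rw [h1, h2]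
          abel
        have hli := hlj.trans hji
        rw [hz, ih (b j) (b l) _ hNmem, ih (b i) (b l) _ hNmem, map_add, map_add,
          aux i j hli hlj, aux j i hlj hli, ih (b i) ⁅b j, b l⁆ _ hNmem,
          ih (b j) ⁅b i, b l⁆ _ hNmem, ih (b i) (b j) _ hNmem, map_add,
          ih ⁅b i, b j⁆ (b l) _ hNmem]
        have jac : ⁅b i, ⁅b j, b l⁆⁆ = ⁅⁅b i, b j⁆, b l⁆ + ⁅b j, ⁅b i, b l⁆⁆ := leibniz_lie _ _ _
        rw [jac, map_add, LinearMap.add_apply]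
        abel
    have key2 : ∀ (i j : ι), degLT F ι (n + 1) ≤ LinearMap.ker
        (A (b i) ∘ₗ A (b j) - A (b j) ∘ₗ A (b i) - A ⁅b i, b j⁆) := by
      intro i j
      refine degLT_induction fun M hM => ?_
      rw [LinearMap.mem_ker]
      simp only [LinearMap.sub_apply, LinearMap.comp_apply]
      rcases lt_trichotomy i j with hij | rfl | hij
      · rw [key j i M hij hM, ← lie_skew (b j) (b i), map_neg, LinearMap.neg_apply]
        abel
      · simp
      · rw [key i j M hij hM]; abel
    intro x y v hv
    let B1 : L →ₗ[F] L →ₗ[F] (Multiset ι →₀ F) :=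
      LinearMap.mk₂ F (fun x y => A x (A y v) - A y (A x v) - A ⁅x, y⁆ v)
        (by intros; simp; abel) (by intros; simp [smul_sub])
        (by intros; simp; abel) (by intros; simp [smul_sub])
    have hB : B1 = 0 := by
      refine b.ext fun i => b.ext fun j => ?_
      have := key2 i j hv
      rw [LinearMap.mem_ker] at this
      exact this
    have := LinearMap.congr_fun₂ hB x y
    simp only [B1, LinearMap.mk₂_apply, LinearMap.zero_apply] at this
    rw [sub_sub, sub_eq_zero] at this
    exact this

lemma act_comm' (x y : L) (v : Multiset ι →₀ F) :
    extAct b (act b) x (extAct b (act b) y v) =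
      extAct b (act b) y (extAct b (act b) x v) + extAct b (act b) ⁅x, y⁆ v := by
  refine act_comm b (v.support.sup Multiset.card + 1) x y v ?_
  intro M hM
  exact Nat.lt_succ_of_le (Finset.le_sup (f := Multiset.card) hM)

attribute [local instance] LieRing.ofAssociativeRing

/-- The Poincaré–Birkhoff–Witt representation. -/
def pbwLie : L →ₗ⁅F⁆ Module.End F (Multiset ι →₀ F) :=
  { extAct b (act b) with
    map_lie' := by
      intro x y
      ext1 M
      ext1
      have := act_comm' b x y (Finsupp.single M 1)
      simp [LieRing.of_associative_ring_bracket, this] }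

/-- Evaluation at the vacuum. -/
def pbwEval : UniversalEnvelopingAlgebra F L →ₗ[F] (Multiset ι →₀ F) :=
  (LinearMap.applyₗ (Finsupp.single (0 : Multiset ι) (1 : F))) ∘ₗ
    (UniversalEnvelopingAlgebra.lift F (pbwLie b)).toLinearMap

lemma pbwEval_mul (x : L) (u : UniversalEnvelopingAlgebra F L) :
    pbwEval b (UniversalEnvelopingAlgebra.ι F x * u) = extAct b (act b) x (pbwEval b u) := by
  simp only [pbwEval, LinearMap.comp_apply, AlgHom.toLinearMap_apply, map_mul,
    UniversalEnvelopingAlgebra.lift_ι_apply]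
  rfl

lemma pbwEval_prod (l : List ι) :
    pbwEval b ((l.map fun i => UniversalEnvelopingAlgebra.ι F (b i)).prod)
      - Finsupp.single (l : Multiset ι) 1 ∈ degLT F ι l.length := by
  induction l with
  | nil => simp [pbwEval]
  | cons i l ih =>
    rw [List.map_cons, List.prod_cons, pbwEval_mul]
    have h1 := extAct_degLT b l.length (fun i M _ => act_lead b _ i M (Nat.lt_succ_self _)) (b i) _ ih
    rw [map_sub, extAct_single] at h1
    have h2 := act_lead b _ i (l : Multiset ι) (Nat.lt_succ_self _)
    have := add_mem h1 h2
    simpa using this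

end PBWRep

section Filt
variable {F : Type*} [Field F] {L : Type*} [LieRing L] [LieAlgebra F L] {ι : Type*}
  {A : Type*} [Ring A] [Algebra F A]

/-- Span of products of fewer than `n` basis elements. -/
def filt (φ : L →ₗ[F] A) (b : Module.Basis ι F L) (n : ℕ) : Submodule F A :=
  Submodule.span F {a | ∃ l : List ι, l.length < n ∧ a = (l.map fun i => φ (b i)).prod}

variable (φ : L →ₗ[F] A) (b : Module.Basis ι F L)

lemma prod_mem_filt {n : ℕ} (l : List ι) (h : l.length < n) :
    (l.map fun i => φ (b i)).prod ∈ filt φ b n := Submodule.subset_span ⟨l, h, rfl⟩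

lemma filt_mono {m n : ℕ} (h : m ≤ n) : filt φ b m ≤ filt φ b n :=
  Submodule.span_mono fun _ ⟨l, hl, e⟩ => ⟨l, lt_of_lt_of_le hl h, e⟩

lemma mul_mem_filt (n : ℕ) (x : L) (a : A) (ha : a ∈ filt φ b n) :
    φ x * a ∈ filt φ b (n + 1) := by
  have h1 : ∀ i : ι, filt φ b n ≤ (filt φ b (n + 1)).comap (LinearMap.mulLeft F (φ (b i))) := by
    intro i
    rw [filt, Submodule.span_le]
    rintro _ ⟨l, hl, rfl⟩
    exact prod_mem_filt φ b (i :: l) (by simpa using hl)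
  have h2 : (⊤ : Submodule F L) ≤
      (filt φ b (n + 1)).comap ((LinearMap.mulRight F a) ∘ₗ φ) := by
    rw [← b.span_eq, Submodule.span_le]
    rintro _ ⟨i, rfl⟩
    exact h1 i ha
  exact h2 (Submodule.mem_top : x ∈ ⊤)

lemma perm_sub_mem_filt (hφ : ∀ x y, φ ⁅x, y⁆ = φ x * φ y - φ y * φ x) {l l' : List ι}
    (h : l.Perm l') :
    (l.map fun i => φ (b i)).prod - (l'.map fun i => φ (b i)).prod ∈ filt φ b l.length := by
  induction h with
  | nil => simp
  | cons x h ih =>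
    simp only [List.map_cons, List.prod_cons, ← mul_sub]
    exact mul_mem_filt φ b _ _ _ ih
  | swap x y l =>
    simp only [List.map_cons, List.prod_cons, ← mul_assoc]
    rw [← sub_mul, ← hφ]
    exact mul_mem_filt φ b _ _ _ (prod_mem_filt φ b l (Nat.lt_succ_self _))
  | trans h1 h2 ih1 ih2 =>
    rw [← h1.length_eq] at ih2
    simpa using add_mem ih1 ih2

lemma filt_le_of_lead (P : Submodule F A)
    (h : ∀ l : List ι, ∃ t ∈ P, (l.map fun i => φ (b i)).prod - t ∈ filt φ b l.length) (n : ℕ) :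
    filt φ b n ≤ P := by
  induction n with
  | zero =>
    rw [filt, Submodule.span_le]
    rintro _ ⟨l, hl, rfl⟩
    omega
  | succ n ih =>
    rw [filt, Submodule.span_le]
    rintro _ ⟨l, hl, rfl⟩
    obtain ⟨t, ht, h'⟩ := h l
    have := add_mem (ih (filt_mono φ b (by omega) h')) ht
    simpa using this

lemma adjoin_le_of_filt (P : Submodule F A) (h : ∀ n, filt φ b n ≤ P) :
    Subalgebra.toSubmodule (Algebra.adjoin F (Set.range φ)) ≤ P := by
  let Q : Submodule F A := ⨆ n, filt φ b n
  have hdir : Directed (· ≤ ·) (filt φ b) :=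
    Monotone.directed_le (fun _ _ h => filt_mono φ b h)
  have hQ : ∀ x a, a ∈ Q → φ x * a ∈ Q := by
    intro x a ha
    obtain ⟨n, hn⟩ := (Submodule.mem_iSup_of_directed _ hdir).1 ha
    exact (Submodule.mem_iSup_of_directed _ hdir).2 ⟨n + 1, mul_mem_filt φ b n x a hn⟩
  have hone : (1 : A) ∈ Q :=
    (Submodule.mem_iSup_of_directed _ hdir).2 ⟨1, prod_mem_filt φ b [] (by simp)⟩
  have main : ∀ u ∈ Algebra.adjoin F (Set.range φ), ∀ a ∈ Q, u * a ∈ Q := by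
    intro u hu
    induction hu using Algebra.adjoin_induction with
    | mem x hx =>
      obtain ⟨x, rfl⟩ := hx
      exact hQ x
    | algebraMap r =>
      intro a ha
      rw [← Algebra.smul_def]
      exact Q.smul_mem r ha
    | add x y _ _ hx hy =>
      intro a ha
      rw [add_mul]
      exact add_mem (hx a ha) (hy a ha)
    | mul x y _ _ hx hy =>
      intro a ha
      rw [mul_assoc]
      exact hx _ (hy a ha)
  intro u hu
  have := main u hu 1 hone
  rw [mul_one] at this
  exact (iSup_le h : Q ≤ P) this

lemma adjoin_range_ι_uea :
    Algebra.adjoin F (Set.range (UniversalEnvelopingAlgebra.ι F : L → _)) = ⊤ := by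
  have h1 : Function.Surjective (UniversalEnvelopingAlgebra.mkAlgHom F L) :=
    RingCon.mkₐ_surjective _
  have h2 := congrArg (Subalgebra.map (UniversalEnvelopingAlgebra.mkAlgHom F L))
    (TensorAlgebra.adjoin_range_ι (R := F) (M := L))
  rw [AlgHom.map_adjoin, Algebra.map_top, (AlgHom.range_eq_top _).2 h1, ← Set.range_comp] at h2
  rw [← h2]
  congr 1

lemma span_lift_eq_top {F A : Type*} [Field F] [AddCommGroup A] [Module F A] {K : Type*}
    (P : Submodule F A) (s : K → A) (hs : ∀ q, s q ∈ P)
    (h : P ≤ Submodule.span F (Set.range s)) :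
    Submodule.span F (Set.range fun q => (⟨s q, hs q⟩ : P)) = ⊤ := by
  rw [eq_top_iff]
  rintro ⟨x, hx⟩ -
  have h1 := h hx
  have e : Set.range s = P.subtype '' (Set.range fun q => (⟨s q, hs q⟩ : P)) := by
    rw [← Set.range_comp]
    rfl
  rw [e, ← Submodule.map_span] at h1
  obtain ⟨y, hy, hyx⟩ := h1
  have : y = ⟨x, hx⟩ := Subtype.ext hyx
  exact this ▸ hy

end Filt

section Symm
variable {F : Type*} [Field F] {V : Type*} [AddCommGroup V] [Module F V]
  {A : Type*} [Ring A] [Algebra F A]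

/-- The symmetrized product as a multilinear map. -/
def symML (ψ : V →ₗ[F] A) (n : ℕ) : MultilinearMap F (fun _ : Fin n => V) A :=
  (n.factorial : F)⁻¹ • ∑ σ : Equiv.Perm (Fin n),
    ((MultilinearMap.mkPiAlgebraFin F n A).compLinearMap (fun _ => ψ)).domDomCongr σ

lemma symML_apply (ψ : V →ₗ[F] A) (n : ℕ) (v : Fin n → V) :
    symML ψ n v = (n.factorial : F)⁻¹ • ∑ σ : Equiv.Perm (Fin n),
      (List.ofFn fun i => ψ (v (σ i))).prod := by
  simp [symML]

lemma symML_of_zero (ψ : V →ₗ[F] A) (n : ℕ) (hn : n = 0) (v : Fin n → V) : symML ψ n v = 1 := by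
  subst hn
  simp [symML_apply]

lemma symML_perm (ψ : V →ₗ[F] A) (n : ℕ) (v : Fin n → V) (τ : Equiv.Perm (Fin n)) :
    symML ψ n (v ∘ τ) = symML ψ n v := by
  rw [symML_apply, symML_apply]
  congr 1
  exact Fintype.sum_equiv (Equiv.mulLeft τ) _ _ (fun σ => rfl)

lemma symML_avg [CharZero F] (ψ : V →ₗ[F] A) (n : ℕ) (v : Fin n → V) {W : Type*} [AddCommGroup W]
    [Module F W] (E : A →ₗ[F] W) (w : W) (P : Submodule F W)
    (h : ∀ σ : Equiv.Perm (Fin n), E ((List.ofFn fun i => ψ (v (σ i))).prod) - w ∈ P) :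
    E (symML ψ n v) - w ∈ P := by
  have h0 : (n.factorial : F) ≠ 0 := by exact_mod_cast n.factorial_ne_zero
  have e : E (symML ψ n v) - w = (n.factorial : F)⁻¹ • ∑ σ : Equiv.Perm (Fin n),
      (E ((List.ofFn fun i => ψ (v (σ i))).prod) - w) := by
    rw [symML_apply, Finset.sum_sub_distrib, Finset.sum_const, Finset.card_univ,
      Fintype.card_perm, Fintype.card_fin, smul_sub, ← Nat.cast_smul_eq_nsmul F, smul_smul,
      inv_mul_cancel₀ h0, one_smul, map_smul, map_sum]
  rw [e]
  exact P.smul_mem _ (P.sum_mem fun σ _ => h σ)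

/-- A tuple enumerating a multiset. -/
lemma exists_tuple {I : Type*} (M : Multiset I) :
    ∃ c : Fin M.card → I, (Finset.univ.val.map c) = M := by
  induction M using Quotient.inductionOn with
  | h l =>
    refine ⟨l.get, ?_⟩
    exact (Fin.univ_val_map l.get).trans (congrArg _ (List.ofFn_get l))

/-- A chosen tuple enumerating a multiset. -/
def tuple {I : Type*} (M : Multiset I) : Fin M.card → I := (exists_tuple M).choose

lemma tuple_spec {I : Type*} (M : Multiset I) : (Finset.univ.val.map (tuple M)) = M :=
  (exists_tuple M).choose_spec

lemma exists_perm_of_map_eq {I : Type*} {n : ℕ} (f g : Fin n → I)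
    (h : Finset.univ.val.map f = Finset.univ.val.map g) :
    ∃ τ : Equiv.Perm (Fin n), f = g ∘ τ := by
  classical
  let _ : LinearOrder I := IsWellOrder.linearOrder WellOrderingRel
  rw [Fin.univ_val_map, Fin.univ_val_map] at h
  have h' : (List.ofFn f).Perm (List.ofFn g) := Multiset.coe_eq_coe.1 h
  have e : f ∘ Tuple.sort f = g ∘ Tuple.sort g :=
    List.ofFn_injective <|
      ((((Tuple.sort f).ofFn_comp_perm f).trans h').trans
        ((Tuple.sort g).ofFn_comp_perm g).symm).eq_of_pairwise'
        (Tuple.monotone_sort f).sortedLE_ofFn.pairwise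
        (Tuple.monotone_sort g).sortedLE_ofFn.pairwise
  refine ⟨(Tuple.sort f).symm.trans (Tuple.sort g), ?_⟩
  ext i
  have := congrFun e ((Tuple.sort f).symm i)
  simpa using this

lemma symML_mem_span {I : Type*} (b : Module.Basis I F V) (ψ : V →ₗ[F] A) (n : ℕ)
    (v : Fin n → V) : symML ψ n v ∈
      Submodule.span F (Set.range fun M : Multiset I => symML ψ M.card (b ∘ tuple M)) := by
  set P := Submodule.span F (Set.range fun M : Multiset I => symML ψ M.card (b ∘ tuple M))
  have h : P.mkQ.compMultilinearMap (symML ψ n) = 0 := by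
    refine Module.Basis.ext_multilinear (fun _ => b) fun c => ?_
    simp only [LinearMap.compMultilinearMap_apply, zero_apply,
      Submodule.mkQ_apply, Submodule.Quotient.mk_eq_zero]
    have key : ∀ M : Multiset I, M = Finset.univ.val.map c →
        symML ψ n (fun i => b (c i)) ∈ P := by
      intro M hM
      have hc : M.card = n := by simp [hM]
      subst hc
      have h1 := tuple_spec M
      have h2 : Finset.univ.val.map c = Finset.univ.val.map (tuple M) := by exact hM.symm.trans h1.symm
      obtain ⟨τ, hτ⟩ := exists_perm_of_map_eq c (tuple M) h2
      have e : (fun i => b (c i)) = (b ∘ tuple M) ∘ τ := by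
        rw [hτ]; rfl
      rw [e, symML_perm]
      exact Submodule.subset_span ⟨M, rfl⟩
    exact key _ rfl
  have := congrArg (fun m => m v) h
  simpa using this

end Symm

section Final

section
attribute [local instance] LieRing.ofAssociativeRing

/-- The canonical map to the enveloping algebra, as a linear map. -/
def ueaLin (F : Type*) [Field F] (L : Type*) [LieRing L] [LieAlgebra F L] :
    L →ₗ[F] UniversalEnvelopingAlgebra F L :=
  (UniversalEnvelopingAlgebra.ι F : L →ₗ⁅F⁆ UniversalEnvelopingAlgebra F L).toLinearMap

lemma ueaLin_lie {F : Type*} [Field F] {L : Type*} [LieRing L] [LieAlgebra F L] (x y : L) :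
    ueaLin F L ⁅x, y⁆ = ueaLin F L x * ueaLin F L y - ueaLin F L y * ueaLin F L x :=
  LieHom.map_lie (UniversalEnvelopingAlgebra.ι F) x y

end

lemma sumMultiset_injective {I J : Type*} : Function.Injective
    (fun p : Multiset I × Multiset J => p.1.map (Sum.inl : I → I ⊕ J) + p.2.map Sum.inr) := by
  rintro ⟨M, N⟩ ⟨M', N'⟩ h
  simp only at h
  have h1 := congrArg (Multiset.filterMap Sum.getLeft?) h
  have h2 := congrArg (Multiset.filterMap Sum.getRight?) h
  have a1 : ∀ (M : Multiset I) (N : Multiset J), Multiset.filterMap Sum.getLeft?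
      (M.map (Sum.inl : I → I ⊕ J) + N.map Sum.inr) = M := by
    intro M N
    induction M using Multiset.induction_on with
    | empty =>
      induction N using Multiset.induction_on with
      | empty => simp
      | cons a N ih => simpa [Multiset.filterMap_cons] using ih
    | cons a M ih => simpa [Multiset.filterMap_cons] using ih
  have a2 : ∀ (M : Multiset I) (N : Multiset J), Multiset.filterMap Sum.getRight?
      (M.map (Sum.inl : I → I ⊕ J) + N.map Sum.inr) = N := by
    intro M N
    induction M using Multiset.induction_on with
    | empty =>
      induction N using Multiset.induction_on with
      | empty => simp
      | cons a N ih => simpa [Multiset.filterMap_cons] using ih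
    | cons a M ih => simpa [Multiset.filterMap_cons] using ih
  rw [a1, a1] at h1
  rw [a2, a2] at h2
  rw [h1, h2]

/-- Unitriangular families are linearly independent. -/
lemma triangular_injective {F : Type*} [Field F] {ι K : Type*} (μ : K → Multiset ι)
    (hμ : Function.Injective μ) (v : K → (Multiset ι →₀ F))
    (hv : ∀ κ, v κ - Finsupp.single (μ κ) 1 ∈ degLT F ι (μ κ).card) :
    Function.Injective (Finsupp.linearCombination F v) := by
  classical
  rw [← LinearMap.ker_eq_bot, LinearMap.ker_eq_bot']
  intro f hf
  by_contra hne
  obtain ⟨κ, hκ, hmax⟩ := f.support.exists_max_image (fun κ => (μ κ).card)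
    (Finsupp.support_nonempty_iff.2 hne)
  have hcoef : ∀ κ' ∈ f.support, v κ' (μ κ) = if κ' = κ then 1 else 0 := by
    intro κ' hκ'
    have h0 : (v κ' - Finsupp.single (μ κ') (1 : F) : Multiset ι →₀ F) (μ κ) = 0 := by
      by_contra hn
      have := hv κ' (Finsupp.mem_support_iff.2 hn)
      have h2 := hmax κ' hκ'
      exact absurd this (not_lt.2 h2)
    rw [Finsupp.sub_apply, sub_eq_zero] at h0
    rw [h0, Finsupp.single_apply]
    simp [hμ.eq_iff]
  have h1 := DFunLike.congr_fun hf (μ κ)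
  rw [Finsupp.linearCombination_apply, Finsupp.sum, Finsupp.finsetSum_apply,
    Finset.sum_congr rfl (g := fun κ' => if κ' = κ then f κ' else 0)] at h1
  · rw [Finset.sum_ite_eq' , if_pos hκ] at h1
    exact (Finsupp.mem_support_iff.1 hκ) h1
  · intro κ' hκ'
    rw [Finsupp.smul_apply, hcoef κ' hκ']
    simp

end Final

theorem pbw_symmetrized_factorization
    (gneg : Submodule k g) (h : LieSubalgebra k g)
    (hcompl : IsCompl gneg h.toSubmodule) :
    Function.Bijective (pbwMul k g gneg h) := by
  classical
  let ιU : g →ₗ[k] UniversalEnvelopingAlgebra k g := ueaLin k g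
  have hιU : ∀ x, ιU x = UniversalEnvelopingAlgebra.ι k x := fun _ => rfl
  have hlie : ∀ x y, ιU ⁅x, y⁆ = ιU x * ιU y - ιU y * ιU x :=
    fun x y => ueaLin_lie x y
  -- bases
  obtain ⟨I, ⟨bn⟩⟩ : ∃ I : Set gneg, Nonempty (Module.Basis I k gneg) :=
    ⟨_, ⟨Module.Basis.ofVectorSpace k gneg⟩⟩
  obtain ⟨J, ⟨bh⟩⟩ : ∃ J : Set h, Nonempty (Module.Basis J k h) :=
    ⟨_, ⟨Module.Basis.ofVectorSpace k h⟩⟩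
  let b : Module.Basis (I ⊕ J) k g :=
    (bn.prod bh).map (Submodule.prodEquivOfIsCompl gneg h.toSubmodule hcompl)
  have hbl : ∀ i : I, b (Sum.inl i) = (bn i : g) := by
    intro i
    simp only [b, Module.Basis.map_apply, Module.Basis.prod_apply]
    erw [Submodule.coe_prodEquivOfIsCompl']
    simp
  have hbr : ∀ j : J, b (Sum.inr j) = (bh j : g) := by
    intro j
    simp only [b, Module.Basis.map_apply, Module.Basis.prod_apply]
    erw [Submodule.coe_prodEquivOfIsCompl']
    simp
  let _ : LinearOrder (I ⊕ J) := IsWellOrder.linearOrder WellOrderingRel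
  let ψ : gneg →ₗ[k] UniversalEnvelopingAlgebra k g := ιU ∘ₗ gneg.subtype
  let φ : h →ₗ[k] UniversalEnvelopingAlgebra k g := ιU ∘ₗ h.toSubmodule.subtype
  have hφlie : ∀ x y, φ ⁅x, y⁆ = φ x * φ y - φ y * φ x := fun x y => hlie x y
  -- the two families
  let s : Multiset I → UniversalEnvelopingAlgebra k g := fun M => symML ψ M.card (bn ∘ tuple M)
  let p : Multiset J → UniversalEnvelopingAlgebra k g := fun N => (N.toList.map fun j => φ (bh j)).prod
  have hs : ∀ M, s M ∈ symmPart k g gneg := by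
    intro M
    rcases Nat.eq_zero_or_pos M.card with h0 | h0
    · have : M = 0 := Multiset.card_eq_zero.1 h0
      subst this
      have : s 0 = 1 := symML_of_zero _ _ h0 _
      rw [this]
      exact Submodule.subset_span (Or.inl rfl)
    · refine Submodule.subset_span (Or.inr ⟨M.card, h0, bn ∘ tuple M, ?_⟩)
      exact symML_apply ψ _ _
  have hp : ∀ N, p N ∈ Subalgebra.toSubmodule (envOfSub k g h) := by
    intro N
    refine Subalgebra.list_prod_mem _ ?_
    intro x hx
    obtain ⟨j, -, rfl⟩ := List.mem_map.1 hx
    exact Algebra.subset_adjoin ⟨bh j, (bh j).2, rfl⟩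
  have hsspan : symmPart k g gneg ≤ Submodule.span k (Set.range s) := by
    rw [symmPart, Submodule.span_le]
    rintro x (hx | ⟨n, -, f, rfl⟩)
    · rw [Set.mem_singleton_iff.1 hx]
      have := symML_mem_span bn ψ 0 (fun _ => 0)
      have e : symML ψ 0 (fun _ => 0) = 1 := by simp [symML_apply]
      rw [e] at this
      exact this
    · have := symML_mem_span bn ψ n f
      rw [symML_apply] at this
      exact this
  have hpspan : Subalgebra.toSubmodule (envOfSub k g h) ≤ Submodule.span k (Set.range p) := by
    have e : envOfSub k g h = Algebra.adjoin k (Set.range φ) := by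
      rw [envOfSub]
      congr 1
      ext x
      constructor
      · rintro ⟨y, hy, rfl⟩
        exact ⟨⟨y, hy⟩, rfl⟩
      · rintro ⟨y, rfl⟩
        exact ⟨y, y.2, rfl⟩
    rw [e]
    refine adjoin_le_of_filt φ bh _ (filt_le_of_lead φ bh _ fun l => ?_)
    refine ⟨p l, Submodule.subset_span ⟨_, rfl⟩, ?_⟩
    refine perm_sub_mem_filt φ bh hφlie ?_
    exact Multiset.coe_eq_coe.1 (by simp)
  -- the product family
  let K := Multiset I × Multiset J
  let μ : K → Multiset (I ⊕ J) := fun q => q.1.map Sum.inl + q.2.map Sum.inr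
  let t : K → UniversalEnvelopingAlgebra k g := fun q => s q.1 * p q.2
  let lst : (q : K) → Equiv.Perm (Fin q.1.card) → List (I ⊕ J) := fun q σ =>
    (List.ofFn fun i => Sum.inl (tuple q.1 (σ i))) ++ q.2.toList.map Sum.inr
  have hlst : ∀ q σ, (lst q σ : Multiset (I ⊕ J)) = μ q := by
    intro q σ
    simp only [lst, μ, ← Multiset.coe_add, ← Multiset.map_coe, Multiset.coe_toList]
    congr 1
    conv_rhs => rw [← tuple_spec q.1]
    rw [Multiset.map_map, Fin.univ_val_map]
    exact Multiset.coe_eq_coe.2 (σ.ofFn_comp_perm (Sum.inl ∘ tuple q.1))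
  have hprod : ∀ q σ, ((lst q σ).map fun i => ιU (b i)).prod =
      (List.ofFn fun i => ψ ((bn ∘ tuple q.1) (σ i))).prod * p q.2 := by
    intro q σ
    simp only [lst, List.map_append, List.prod_append, List.map_ofFn, List.map_map]
    congr 2
    · congr 1
      funext i
      exact congrArg ιU (hbl _)
    · refine List.map_congr_left fun j _ => ?_
      exact congrArg ιU (hbr _)
  have hlen : ∀ q σ, (lst q σ).length = (μ q).card := fun q σ => by
    rw [← hlst q σ, Multiset.coe_card]
  -- leading terms under evaluation
  have heval : ∀ q, pbwEval b (t q) - Finsupp.single (μ q) 1 ∈ degLT k (I ⊕ J) (μ q).card := by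
    intro q
    refine symML_avg ψ q.1.card (bn ∘ tuple q.1)
      (pbwEval b ∘ₗ LinearMap.mulRight k (p q.2)) _ _ fun σ => ?_
    have := pbwEval_prod b (lst q σ)
    rw [hlst, hlen] at this
    rw [LinearMap.comp_apply, LinearMap.mulRight_apply, ← hprod]
    exact this
  have hTinj : Function.Injective (Finsupp.linearCombination k t) := by
    have h1 := triangular_injective μ sumMultiset_injective (fun q => pbwEval b (t q)) heval
    have h2 : Finsupp.linearCombination k (fun q => pbwEval b (t q)) =
        pbwEval b ∘ₗ Finsupp.linearCombination k t := by
      ext1 q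
      ext1
      simp
    rw [h2, LinearMap.coe_comp] at h1
    exact h1.of_comp
  have hTsurj : Function.Surjective (Finsupp.linearCombination k t) := by
    rw [← LinearMap.range_eq_top, Finsupp.range_linearCombination, eq_top_iff]
    have h1 : (⊤ : Submodule k (UniversalEnvelopingAlgebra k g)) =
        Subalgebra.toSubmodule (Algebra.adjoin k (Set.range ιU)) := by
      have : Algebra.adjoin k (Set.range ιU) = ⊤ := adjoin_range_ι_uea
      rw [this]
      rfl
    rw [h1]
    refine adjoin_le_of_filt ιU b _ (filt_le_of_lead ιU b _ fun l => ?_)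
    obtain ⟨q, hq⟩ : ∃ q : K, μ q = l := by
      induction l with
      | nil => exact ⟨(0, 0), by simp [μ]⟩
      | cons a l ih =>
        obtain ⟨⟨M, N⟩, ih⟩ := ih
        rcases a with i | j
        · exact ⟨(i ::ₘ M, N), by simp only [μ] at ih ⊢; simp [← Multiset.cons_coe, ← ih]⟩
        · exact ⟨(M, j ::ₘ N), by simp only [μ] at ih ⊢; simp [← Multiset.cons_coe, ← ih]⟩
    refine ⟨t q, Submodule.subset_span ⟨q, rfl⟩, ?_⟩
    rw [← neg_mem_iff, neg_sub]
    refine symML_avg ψ q.1.card (bn ∘ tuple q.1)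
      (LinearMap.mulRight k (p q.2)) _ _ fun σ => ?_
    rw [LinearMap.mulRight_apply, ← hprod]
    have hperm : (lst q σ).Perm l := Multiset.coe_eq_coe.1 ((hlst q σ).trans hq)
    have := perm_sub_mem_filt ιU b hlie hperm
    rw [hperm.length_eq] at this
    exact this
  -- conclude
  let Q : (K →₀ k) →ₗ[k] (symmPart k g gneg ⊗[k] Subalgebra.toSubmodule (envOfSub k g h)) :=
    Finsupp.linearCombination k (fun q : K => (⟨s q.1, hs q.1⟩ : symmPart k g gneg) ⊗ₜ[k]
      (⟨p q.2, hp q.2⟩ : Subalgebra.toSubmodule (envOfSub k g h)))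
  have hQT : pbwMul k g gneg h ∘ₗ Q = Finsupp.linearCombination k t := by
    ext1 q
    ext1
    simp [Q, pbwMul, t]
  have hspan1 := span_lift_eq_top _ s hs hsspan
  have hspan2 := span_lift_eq_top _ p hp hpspan
  have hQsurj : Function.Surjective Q := by
    rw [← LinearMap.range_eq_top, Finsupp.range_linearCombination, eq_top_iff,
      ← TensorProduct.map₂_mk_top_top_eq_top, ← hspan1, ← hspan2, Submodule.map₂_span_span,
      Submodule.span_le]
    rintro _ ⟨_, ⟨M, rfl⟩, _, ⟨N, rfl⟩, rfl⟩
    exact Submodule.subset_span ⟨(M, N), rfl⟩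
  have hcomp : ∀ z, pbwMul k g gneg h (Q z) = Finsupp.linearCombination k t z := fun z =>
    LinearMap.congr_fun hQT z
  constructor
  · intro x y hxy
    obtain ⟨x, rfl⟩ := hQsurj x
    obtain ⟨y, rfl⟩ := hQsurj y
    rw [hcomp, hcomp] at hxy
    rw [hTinj hxy]
  · intro u
    obtain ⟨z, rfl⟩ := hTsurj u
    exact ⟨Q z, hcomp z⟩

end
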